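/- Mixed derivative formula for a bundled criterion function: let H be a normed vector space over ℝ, let m : ℝ^d × H → ℝ be twice continuously Fréchet differentiable, let ζ : ℝ^d → H be differentiable, and let h : ℝ^d → H be differentiable. For η ∈ ℝ define φ(η, β) = D(β' ↦ m(β', ζ(β') + η h(β')))(β), the derivative in β of the perturbed composite. Then for every β, the derivative of η ↦ φ(η, β) at η = 0 exists and equals, as a linear map on ℝ^d, u ↦ D₁₂m(β,ζ(β))[u, h(β)] + D₂₂m(β,ζ(β))[Dζ(β)u, h(β)] + D₂m(β,ζ(β))[Dh(β)u]. -/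

import Mathlib

/-- **Mixed derivative formula for a bundled criterion function.**
Let `H` be a normed space over `ℝ`, `m : ℝ^d × H → ℝ` twice continuously Fréchet
differentiable, and let `ζ, h : ℝ^d → H` be differentiable.  For
`φ(η, β) = D(β' ↦ m(β', ζ(β') + η h(β')))(β)`, the derivative of `η ↦ φ(η, β)` at
`η = 0` exists and equals, as a linear map on `ℝ^d`,
`u ↦ D₁₂m(β,ζ(β))[u, h(β)] + D₂₂m(β,ζ(β))[Dζ(β)u, h(β)] + D₂m(β,ζ(β))[Dh(β)u]`. -/
theorem bundled_mixed_derivative_formula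
    {d : ℕ} {H : Type*} [NormedAddCommGroup H] [NormedSpace ℝ H]
    (m : (Fin d → ℝ) × H → ℝ) (hm : ContDiff ℝ 2 m)
    (ζ h : (Fin d → ℝ) → H)
    (hζ : Differentiable ℝ ζ) (hh : Differentiable ℝ h)
    (β : Fin d → ℝ) :
    ∃ Ψ : (Fin d → ℝ) →L[ℝ] ℝ,
      HasDerivAt (fun η : ℝ => fderiv ℝ (fun β' => m (β', ζ β' + η • h β')) β) Ψ 0 ∧
      ∀ u : Fin d → ℝ,
        Ψ u = fderiv ℝ (fderiv ℝ m) (β, ζ β) (u, 0) (0, h β)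
          + fderiv ℝ (fderiv ℝ m) (β, ζ β) (0, fderiv ℝ ζ β u) (0, h β)
          + fderiv ℝ m (β, ζ β) (0, fderiv ℝ h β u) := by
  have hm1 : Differentiable ℝ m := hm.differentiable (by norm_num)
  have hm2 : Differentiable ℝ (fderiv ℝ m) :=
    (hm.fderiv_right (m := 1) (by norm_num)).differentiable (by norm_num)
  have hsymm : IsSymmSndFDerivAt ℝ m (β, ζ β) :=
    hm.contDiffAt.isSymmSndFDerivAt (by simp)
  have key : (fun η : ℝ => fderiv ℝ (fun β' => m (β', ζ β' + η • h β')) β) =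
      fun η : ℝ => (fderiv ℝ m (β, ζ β + η • h β)).comp
        ((ContinuousLinearMap.id ℝ (Fin d → ℝ)).prod (fderiv ℝ ζ β + η • fderiv ℝ h β)) := by
    funext η
    have h1 : HasFDerivAt (fun β' => (β', ζ β' + η • h β'))
        ((ContinuousLinearMap.id ℝ (Fin d → ℝ)).prod (fderiv ℝ ζ β + η • fderiv ℝ h β)) β :=
      (hasFDerivAt_id β).prodMk
        ((hζ β).hasFDerivAt.add ((hh β).hasFDerivAt.const_smul η))
    exact ((hm1 (β, ζ β + η • h β)).hasFDerivAt.comp β h1).fderiv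
  have hp : HasDerivAt (fun η : ℝ => (β, ζ β + η • h β)) ((0 : Fin d → ℝ), h β) 0 := by
    have := ((hasDerivAt_id (0 : ℝ)).smul_const (h β)).const_add (ζ β)
    simpa using (hasDerivAt_const (0 : ℝ) β).prodMk this
  have hc : HasDerivAt (fun η : ℝ => fderiv ℝ m (β, ζ β + η • h β))
      (fderiv ℝ (fderiv ℝ m) (β, ζ β) (0, h β)) 0 := by
    have h2 : HasFDerivAt (fderiv ℝ m) (fderiv ℝ (fderiv ℝ m) (β, ζ β))
        (β, ζ β + (0 : ℝ) • h β) := by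
      simpa using (hm2 (β, ζ β)).hasFDerivAt
    exact h2.comp_hasDerivAt (0 : ℝ) hp
  have hL : HasDerivAt (fun η : ℝ =>
      (ContinuousLinearMap.id ℝ (Fin d → ℝ)).prod (fderiv ℝ ζ β + η • fderiv ℝ h β))
      ((0 : (Fin d → ℝ) →L[ℝ] (Fin d → ℝ)).prod (fderiv ℝ h β)) 0 := by
    have e : (fun η : ℝ =>
      (ContinuousLinearMap.id ℝ (Fin d → ℝ)).prod (fderiv ℝ ζ β + η • fderiv ℝ h β)) =
      fun η : ℝ => (ContinuousLinearMap.id ℝ (Fin d → ℝ)).prod (fderiv ℝ ζ β) +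
        η • (0 : (Fin d → ℝ) →L[ℝ] (Fin d → ℝ)).prod (fderiv ℝ h β) := by
      funext η
      ext u <;> simp
    rw [e]
    simpa using ((hasDerivAt_id (0 : ℝ)).smul_const
      ((0 : (Fin d → ℝ) →L[ℝ] (Fin d → ℝ)).prod (fderiv ℝ h β))).const_add
      ((ContinuousLinearMap.id ℝ (Fin d → ℝ)).prod (fderiv ℝ ζ β))
  rw [key]
  refine ⟨_, hc.clm_comp hL, fun u => ?_⟩
  have hs : ((u, fderiv ℝ ζ β u) : (Fin d → ℝ) × H) = (u, 0) + (0, fderiv ℝ ζ β u) := by simp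
  have e1 := hsymm (u, 0) (0, h β)
  have e2 := hsymm (0, fderiv ℝ ζ β u) (0, h β)
  rw [e1, e2, ← map_add, ← hs]
  simp
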